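/- Let Z be a metric space, let Φ : D_Φ ⊆ Z → Z and Ψ : D_Ψ ⊆ Z → Z be maps, and let R̃_1 = (R_1, R_1⁻) and R̃_2 = (R_2, R_2⁻) be oriented rectangles in Z, with R_1 = h_1([0,1]²) and upper and lower sides R_1⁺_up = h_1([0,1]×{1}), R_1⁺_down = h_1([0,1]×{0}). Suppose there exist m_1 ≥ 1 pairwise disjoint compact sets H_1, …, H_{m_1} ⊆ R_1 ∩ D_Φ with (H_i, Φ) stretching R̃_1 to R̃_2 along the paths, and m_2 ≥ 1 pairwise disjoint compact sets K_1, …, K_{m_2} ⊆ R_2 ∩ D_Ψ with (K_j, Ψ) stretching R̃_2 to R̃_1 along the paths. Set ψ := Ψ ∘ Φ and H'_{i,j} := H_i ∩ Φ^{−1}(K_j). Then for each one-sided sequence of symbols s = ((p_n, q_n))_{n∈ℕ} ∈ ({1,…,m_1} × {1,…,m_2})^ℕ there exists a compact connected set C_s ⊆ H'_{p_0,q_0} with C_s ∩ R_1⁺_down ≠ ∅ and C_s ∩ R_1⁺_up ≠ ∅, such that for every w ∈ C_s there exists a sequence (y_n)_{n∈ℕ} with y_0 = w, y_n ∈ H'_{p_n,q_n}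 and ψ(y_n) = y_{n+1} for all n ≥ 0. -/

import Mathlib

/-- An oriented rectangle in a metric space `Z`: a homeomorphic copy of the unit square
`[0,1]²` (encoded by a map which is continuous and injective on the square — since the
square is compact and `Z` is Hausdorff, this is a homeomorphism onto its image),
together with the induced left/right (and down/up) sides. -/
structure OrientedRectangle (Z : Type*) [MetricSpace Z] where
  toFun : ℝ × ℝ → Z
  continuousOn : ContinuousOn toFun (Set.Icc (0 : ℝ) 1 ×ˢ Set.Icc (0 : ℝ) 1)
  injOn : Set.InjOn toFun (Set.Icc (0 : ℝ) 1 ×ˢ Set.Icc (0 : ℝ) 1)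

namespace OrientedRectangle

variable {Z : Type*} [MetricSpace Z] (R : OrientedRectangle Z)

/-- The generalized rectangle `R = h([0,1]²)`. -/
def carrier : Set Z := R.toFun '' (Set.Icc (0 : ℝ) 1 ×ˢ Set.Icc (0 : ℝ) 1)

/-- The left side `R⁻_left = h({0} × [0,1])`. -/
def left : Set Z := R.toFun '' (({0} : Set ℝ) ×ˢ Set.Icc (0 : ℝ) 1)

/-- The right side `R⁻_right = h({1} × [0,1])`. -/
def right : Set Z := R.toFun '' (({1} : Set ℝ) ×ˢ Set.Icc (0 : ℝ) 1)

/-- The down side `R⁺_down = h([0,1] × {0})`. -/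
def down : Set Z := R.toFun '' (Set.Icc (0 : ℝ) 1 ×ˢ ({0} : Set ℝ))

/-- The up side `R⁺_up = h([0,1] × {1})`. -/
def up : Set Z := R.toFun '' (Set.Icc (0 : ℝ) 1 ×ˢ ({1} : Set ℝ))

end OrientedRectangle

/-- `(K, ψ)` stretches the oriented rectangle `X` to the oriented rectangle `Y` along
the paths: `K ⊆ X` is compact, `ψ` is continuous on `K`, and every path in `X` joining
the two components of `X⁻` admits a subpath lying in `K` which is mapped by `ψ` into `Y`
joining the two components of `Y⁻`. -/
def StretchesTo {Z : Type*} [MetricSpace Z] (K : Set Z) (ψ : Z → Z)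
    (X Y : OrientedRectangle Z) : Prop :=
  IsCompact K ∧ K ⊆ X.carrier ∧ ContinuousOn ψ K ∧
  ∀ γ : ℝ → Z, ContinuousOn γ (Set.Icc (0 : ℝ) 1) →
    (∀ t ∈ Set.Icc (0 : ℝ) 1, γ t ∈ X.carrier) →
    ((γ 0 ∈ X.left ∧ γ 1 ∈ X.right) ∨ (γ 0 ∈ X.right ∧ γ 1 ∈ X.left)) →
    ∃ t' t'' : ℝ, t' ∈ Set.Icc (0 : ℝ) 1 ∧ t'' ∈ Set.Icc (0 : ℝ) 1 ∧ t' ≤ t'' ∧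
      (∀ t ∈ Set.Icc t' t'', γ t ∈ K ∧ ψ (γ t) ∈ Y.carrier) ∧
      ((ψ (γ t') ∈ Y.left ∧ ψ (γ t'') ∈ Y.right) ∨
        (ψ (γ t') ∈ Y.right ∧ ψ (γ t'') ∈ Y.left))

section Helpers

open Set Topology

/-- A continuous integer valued function on the line is constant. -/
lemma aux_const (F : ℝ → ℝ) (hF : Continuous F)
    (h : ∀ t, ((F t : ℝ) : AddCircle (1 : ℝ)) = 0) (a b : ℝ) : F a = F b := by
  have := (AddCircle.isCoveringMap_coe (1 : ℝ)).eq_of_comp_eq (g₁ := F) (g₂ := fun _ => F b)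
    hF continuous_const (by funext t; simp [h]) b rfl
  exact congrFun this a

lemma aux_crossing (f : ℝ × ℝ → ℝ) (hf : Continuous f) (h01 : ∀ p, f p ∈ Icc (0 : ℝ) 1)
    (h0 : ∀ x, f (x, 0) = 0) (h1 : ∀ x, f (x, 1) = 1) :
    ∃ a b : ℝ, JoinedIn {p | f p ∈ Ioo (0 : ℝ) 1} (0, a) (1, b) := by
  classical
  by_contra hno
  push Not at hno
  set U : Set (ℝ × ℝ) := {p | f p ∈ Ioo (0 : ℝ) 1} with hU
  have hUo : IsOpen U := isOpen_Ioo.preimage hf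
  set V : Set (ℝ × ℝ) := {p | ∃ a : ℝ, JoinedIn U (0, a) p} with hV
  have hVo : IsOpen V := by
    have : V = ⋃ a : ℝ, pathComponentIn U (0, a) := by
      ext p; simp [hV, pathComponentIn]
    rw [this]
    exact isOpen_iUnion fun a => hUo.pathComponentIn _
  have hcoe : ∀ p, p ∉ U → ((f p : ℝ) : AddCircle (1 : ℝ)) = 0 := by
    intro p hp
    have h := h01 p
    rcases h.1.eq_or_lt with h' | h'
    · rw [← h']; simp
    · rcases h.2.eq_or_lt with h'' | h''
      · rw [h'']; exact AddCircle.coe_period 1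
      · exact absurd ⟨h', h''⟩ hp
  let g : ℝ × ℝ → AddCircle (1 : ℝ) := fun p => if p ∈ V then ((f p : ℝ) : AddCircle (1 : ℝ)) else 0
  have hg : Continuous g := by
    refine Continuous.if ?_ ((AddCircle.continuous_mk' (1 : ℝ)).comp hf) continuous_const
    intro p hp
    apply hcoe
    intro hpU
    have hp1 : p ∈ closure V := frontier_subset_closure hp
    have hp2 : p ∉ V := by
      have := hp.2
      rwa [show interior {a | a ∈ V} = V from hVo.interior_eq] at this
    obtain ⟨q, hq1, a, hq2⟩ := mem_closure_iff.1 hp1 _ (hUo.pathComponentIn p)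
      (mem_pathComponentIn_self hpU)
    exact hp2 ⟨a, hq2.trans (JoinedIn.symm hq1)⟩
  have hg00 : g (0, 0) = 0 := by
    simp only [g]; split_ifs
    · simp [h0]
    · rfl
  obtain ⟨G, ⟨hG0, hGl⟩, -⟩ := (AddCircle.isCoveringMap_coe (1 : ℝ)).existsUnique_continuousMap_lifts
    ⟨g, hg⟩ ((0 : ℝ), (0 : ℝ)) (0 : ℝ) (by simp [hg00])
  have hGp : ∀ p, ((G p : ℝ) : AddCircle (1 : ℝ)) = g p := fun p => congrFun hGl p
  have hgb : ∀ x, g (x, 0) = 0 := by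
    intro x; simp only [g]; split_ifs
    · simp [h0]
    · rfl
  have hgt : ∀ x, g (x, 1) = 0 := by
    intro x; simp only [g]; split_ifs
    · rw [h1]; exact AddCircle.coe_period 1
    · rfl
  have hgr : ∀ y, g (1, y) = 0 := by
    intro y
    exact if_neg (fun ⟨a, ha⟩ => hno a y ha)
  have hgl : ∀ y, g (0, y) = ((f (0, y) : ℝ) : AddCircle (1 : ℝ)) := by
    intro y
    by_cases hy : (0, y) ∈ U
    · exact if_pos ⟨y, JoinedIn.refl hy⟩
    · simp only [g]; rw [hcoe _ hy]; simp
  have e1 := aux_const (fun x => G (x, 0)) (by fun_prop) (fun x => by rw [hGp, hgb]) 0 1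
  have e2 := aux_const (fun x => G (x, 1)) (by fun_prop) (fun x => by rw [hGp, hgt]) 0 1
  have e3 := aux_const (fun y => G (1, y)) (by fun_prop) (fun x => by rw [hGp, hgr]) 0 1
  have e4 := aux_const (fun y => G (0, y) - f (0, y)) (by fun_prop)
    (fun x => by rw [AddCircle.coe_sub, hGp, hgl, sub_self]) 0 1
  simp only [h0, h1] at e1 e2 e3 e4
  linarith

/-- Whyburn-type separation lemma. -/
lemma aux_sep (T B U : Set (ℝ × ℝ)) (hT : IsCompact T) (hB : IsClosed B) (hU : IsClosed U)
    (hno : ∀ C ⊆ T, IsCompact C → IsConnected C → (C ∩ B).Nonempty → ¬ (C ∩ U).Nonempty) :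
    ∃ A₀ A₁ : Set (ℝ × ℝ), IsClosed A₀ ∧ IsClosed A₁ ∧ A₀ ∪ A₁ = T ∧ Disjoint A₀ A₁ ∧
      Disjoint A₀ U ∧ Disjoint A₁ B := by
  haveI : CompactSpace T := isCompact_iff_compactSpace.1 hT
  let π : T → ConnectedComponents T := (↑)
  have hπ : Continuous π := ConnectedComponents.continuous_coe
  have hcl : ∀ S : Set (ℝ × ℝ), IsClosed S → IsClosed (π '' (Subtype.val ⁻¹' S)) := fun S hS =>
    ((hS.preimage continuous_subtype_val).isCompact.image hπ).isClosed
  have hdis : π '' (Subtype.val ⁻¹' B) ⊆ (π '' (Subtype.val ⁻¹' U))ᶜ := by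
    rintro _ ⟨x, hx, rfl⟩ ⟨y, hy, hxy⟩
    have hyx : y ∈ connectedComponent x := by
      rw [← ConnectedComponents.coe_eq_coe'] ; exact hxy
    refine hno (Subtype.val '' connectedComponent x) ?_ ?_ ?_ ⟨x, ⟨x, mem_connectedComponent, rfl⟩, hx⟩
      ⟨y, ⟨y, hyx, rfl⟩, hy⟩
    · rintro _ ⟨z, -, rfl⟩; exact z.2
    · exact isClosed_connectedComponent.isCompact.image continuous_subtype_val
    · exact isConnected_connectedComponent.image _ continuous_subtype_val.continuousOn
  obtain ⟨W, hW, hBW, hWU⟩ := exists_clopen_of_closed_subset_open (hcl B hB) (hcl U hU).isOpen_compl hdis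
  refine ⟨Subtype.val '' (π ⁻¹' W), Subtype.val '' (π ⁻¹' W)ᶜ, ?_, ?_, ?_, ?_, ?_, ?_⟩
  · exact ((hW.1.preimage hπ).isCompact.image continuous_subtype_val).isClosed
  · exact (((hW.2.preimage hπ).isClosed_compl).isCompact.image continuous_subtype_val).isClosed
  · rw [← image_union, union_compl_self, image_univ, Subtype.range_coe]
  · exact (disjoint_image_iff Subtype.val_injective).2 disjoint_compl_right
  · rw [Set.disjoint_left]
    rintro _ ⟨x, hx, rfl⟩ hxU
    exact hWU hx ⟨x, hxU, rfl⟩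
  · rw [Set.disjoint_left]
    rintro _ ⟨x, hx, rfl⟩ hxB
    exact hx (hBW ⟨x, hxB, rfl⟩)

/-- Clamping to the unit interval. -/
def auxClamp (p : ℝ × ℝ) : ℝ × ℝ := (max 0 (min 1 p.1), max 0 (min 1 p.2))

lemma auxClamp_cont : Continuous auxClamp := by unfold auxClamp; fun_prop

lemma auxClamp_mem (p : ℝ × ℝ) : auxClamp p ∈ Icc (0 : ℝ) 1 ×ˢ Icc (0 : ℝ) 1 := by
  simp [auxClamp, mem_prod]

/-- Crossing lemma in the square. -/
lemma aux_square (T : Set (ℝ × ℝ)) (hT : IsCompact T) (hTQ : T ⊆ Icc (0 : ℝ) 1 ×ˢ Icc (0 : ℝ) 1)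
    (hpath : ∀ γ : ℝ → ℝ × ℝ, Continuous γ → (∀ t, γ t ∈ Icc (0 : ℝ) 1 ×ˢ Icc (0 : ℝ) 1) →
      (γ 0).1 = 0 → (γ 1).1 = 1 → ∃ t, γ t ∈ T) :
    ∃ C ⊆ T, IsCompact C ∧ IsConnected C ∧ (C ∩ {p | p.2 ≤ 0}).Nonempty ∧
      (C ∩ {p | 1 ≤ p.2}).Nonempty := by
  by_contra hno
  have hB : IsClosed {p : ℝ × ℝ | p.2 ≤ 0} := isClosed_le continuous_snd continuous_const
  have hU : IsClosed {p : ℝ × ℝ | 1 ≤ p.2} := isClosed_le continuous_const continuous_snd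
  obtain ⟨A₀, A₁, hA₀, hA₁, hun, hd, hd0, hd1⟩ := aux_sep T _ _ hT hB hU
    (fun C h1 h2 h3 h4 h5 => hno ⟨C, h1, h2, h3, h4, h5⟩)
  have hdisj : Disjoint (A₀ ∪ {p : ℝ × ℝ | p.2 ≤ 0}) (A₁ ∪ {p : ℝ × ℝ | 1 ≤ p.2}) := by
    rw [disjoint_union_left, disjoint_union_right, disjoint_union_right]
    refine ⟨⟨hd, hd0⟩, hd1.symm, ?_⟩
    rw [Set.disjoint_left]
    intro p h1 h2
    simp only [mem_setOf_eq] at h1 h2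
    linarith
  obtain ⟨f, hf0, hf1, hf⟩ := exists_continuous_zero_one_of_isClosed (hA₀.union hB) (hA₁.union hU) hdisj
  have hF : ∀ p, f (auxClamp p) ∈ Icc (0 : ℝ) 1 := fun p => hf _
  obtain ⟨a, b, hab⟩ := aux_crossing (fun p => f (auxClamp p)) (f.continuous.comp auxClamp_cont) hF
    (fun x => hf0 (Or.inr (by simp [auxClamp]))) (fun x => hf1 (Or.inr (by simp [auxClamp])))
  obtain ⟨γ, hγ⟩ := hab
  obtain ⟨t, ht⟩ := hpath (fun t => auxClamp (γ.extend t))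
    (auxClamp_cont.comp γ.continuous_extend) (fun t => auxClamp_mem _)
    (by simp [auxClamp]) (by simp [auxClamp])
  have hm : f (auxClamp (γ.extend t)) ∈ Ioo (0 : ℝ) 1 := hγ (projIcc 0 1 zero_le_one t)
  rw [← hun] at ht
  rcases ht with ht | ht
  · have := hf0 (Or.inl ht); simp only [Pi.zero_apply] at this; rw [this] at hm
    exact lt_irrefl _ hm.1
  · have := hf1 (Or.inl ht); simp only [Pi.one_apply] at this; rw [this] at hm
    exact lt_irrefl _ hm.2

variable {Z : Type*} [MetricSpace Z]

lemma aux_rect (R : OrientedRectangle Z) (S : Set Z) (hS : IsClosed S)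
    (hpath : ∀ γ : ℝ → Z, ContinuousOn γ (Icc (0 : ℝ) 1) →
      (∀ t ∈ Icc (0 : ℝ) 1, γ t ∈ R.carrier) → (γ 0 ∈ R.left ∧ γ 1 ∈ R.right) →
      ∃ t, γ t ∈ S) :
    ∃ C ⊆ S, IsCompact C ∧ IsConnected C ∧ (C ∩ R.down).Nonempty ∧ (C ∩ R.up).Nonempty := by
  have hQ : IsCompact (Icc (0 : ℝ) 1 ×ˢ Icc (0 : ℝ) 1) := isCompact_Icc.prod isCompact_Icc
  obtain ⟨C, hCT, hCc, hCn, ⟨p, hpC, hp⟩, ⟨q, hqC, hq⟩⟩ := aux_square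
    ((Icc (0 : ℝ) 1 ×ˢ Icc (0 : ℝ) 1) ∩ R.toFun ⁻¹' S)
    (hQ.of_isClosed_subset (R.continuousOn.preimage_isClosed_of_isClosed hQ.isClosed hS)
      inter_subset_left) inter_subset_left (by
      intro γ hγ hγQ h0 h1
      obtain ⟨t, ht⟩ := hpath (R.toFun ∘ γ)
        (R.continuousOn.comp hγ.continuousOn (fun t _ => hγQ t))
        (fun t _ => ⟨γ t, hγQ t, rfl⟩)
        ⟨⟨γ 0, ⟨h0, (hγQ 0).2⟩, rfl⟩, ⟨γ 1, ⟨h1, (hγQ 1).2⟩, rfl⟩⟩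
      exact ⟨t, hγQ t, ht⟩)
  have hcont : ContinuousOn R.toFun C := R.continuousOn.mono fun x hx => (hCT hx).1
  refine ⟨R.toFun '' C, ?_, hCc.image_of_continuousOn hcont, hCn.image _ hcont, ?_, ?_⟩
  · rintro _ ⟨x, hx, rfl⟩; exact (hCT hx).2
  · exact ⟨R.toFun p, ⟨p, hpC, rfl⟩, p, ⟨(hCT hpC).1.1, le_antisymm hp (hCT hpC).1.2.1⟩, rfl⟩
  · exact ⟨R.toFun q, ⟨q, hqC, rfl⟩, q, ⟨(hCT hqC).1.1, le_antisymm (hCT hqC).1.2.2 hq⟩, rfl⟩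

lemma StretchesTo.aux_comp {H K : Set Z} {Φ Ψ : Z → Z} {X Y W : OrientedRectangle Z}
    (h1 : StretchesTo H Φ X Y) (h2 : StretchesTo K Ψ Y W) :
    StretchesTo (H ∩ Φ ⁻¹' K) (Ψ ∘ Φ) X W := by
  obtain ⟨hc1, hs1, hf1, hp1⟩ := h1
  obtain ⟨hc2, hs2, hf2, hp2⟩ := h2
  refine ⟨hc1.of_isClosed_subset (hf1.preimage_isClosed_of_isClosed hc1.isClosed hc2.isClosed)
    inter_subset_left, fun x hx => hs1 hx.1, hf2.comp (hf1.mono inter_subset_left) (fun x hx => hx.2),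
    ?_⟩
  intro γ hγ hγX hγe
  obtain ⟨a, b, ha, hb, hab, hin, hend⟩ := hp1 γ hγ hγX hγe
  let r : ℝ → ℝ := fun t => a + t * (b - a)
  have hr : ∀ t ∈ Icc (0 : ℝ) 1, r t ∈ Icc a b := by
    intro t ht
    have hba : 0 ≤ b - a := by linarith
    constructor
    · have := mul_nonneg ht.1 hba
      simp only [r]; linarith
    · have := mul_nonneg (sub_nonneg.2 ht.2) hba
      simp only [r]; linarith
  have hr0 : r 0 = a := by simp [r]
  have hr1 : r 1 = b := by simp [r]
  have hrc : Continuous r := by fun_prop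
  have hsub : Icc a b ⊆ Icc (0 : ℝ) 1 := Icc_subset_Icc ha.1 hb.2
  obtain ⟨c, d, hc, hd, hcd, hin2, hend2⟩ := hp2 (fun t => Φ (γ (r t)))
    (hf1.comp (hγ.comp hrc.continuousOn (fun t ht => hsub (hr t ht))) fun t ht => (hin _ (hr t ht)).1)
    (fun t ht => (hin _ (hr t ht)).2) (by simpa only [hr0, hr1] using hend)
  have hba : 0 ≤ b - a := by linarith
  have hrcd : r c ≤ r d := by
    have := mul_le_mul_of_nonneg_right hcd hba
    simp only [r]; linarith
  refine ⟨r c, r d, hsub (hr c hc), hsub (hr d hd), hrcd, ?_, hend2⟩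
  intro u hu
  have : u ∈ r '' Icc c d := intermediate_value_Icc hcd hrc.continuousOn hu
  obtain ⟨t, ht, rfl⟩ := this
  have ht' : t ∈ Icc (0 : ℝ) 1 := ⟨hc.1.trans ht.1, ht.2.trans hd.2⟩
  exact ⟨⟨(hin _ (hr t ht')).1, (hin2 t ht).1⟩, (hin2 t ht).2⟩

lemma StretchesTo.aux_id (X : OrientedRectangle Z) : StretchesTo X.carrier id X X := by
  refine ⟨(isCompact_Icc.prod isCompact_Icc).image_of_continuousOn X.continuousOn, Subset.rfl,
    continuousOn_id, ?_⟩
  intro γ _ hX he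
  exact ⟨0, 1, by simp, by simp, zero_le_one, fun t ht => ⟨hX t ht, hX t ht⟩, he⟩

/-- Points whose first `N` iterates follow the itinerary `M`. -/
def auxE (X : OrientedRectangle Z) (ψ : Z → Z) : ℕ → (ℕ → Set Z) → Set Z
  | 0, _ => X.carrier
  | N + 1, M => M 0 ∩ ψ ⁻¹' auxE X ψ N (fun n => M (n + 1))

lemma auxE_stretch (X : OrientedRectangle Z) (ψ : Z → Z) (N : ℕ) : ∀ M : ℕ → Set Z,
    (∀ n, StretchesTo (M n) ψ X X) → StretchesTo (auxE X ψ N M) (ψ^[N]) X X := by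
  induction N with
  | zero => intro M _; exact StretchesTo.aux_id X
  | succ N ih => intro M hM; exact (hM 0).aux_comp (ih _ fun n => hM (n + 1))

lemma auxE_anti (X : OrientedRectangle Z) (ψ : Z → Z) (N : ℕ) : ∀ M : ℕ → Set Z,
    (∀ n, M n ⊆ X.carrier) → auxE X ψ (N + 1) M ⊆ auxE X ψ N M := by
  induction N with
  | zero => intro M hM x hx; exact hM 0 hx.1
  | succ N ih => intro M hM x hx; exact ⟨hx.1, ih _ (fun n => hM (n + 1)) hx.2⟩

lemma auxE_orbit (X : OrientedRectangle Z) (ψ : Z → Z) (N : ℕ) : ∀ (M : ℕ → Set Z) (w : Z),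
    w ∈ auxE X ψ (N + 1) M → ψ^[N] w ∈ M N := by
  induction N with
  | zero => intro M w hw; exact hw.1
  | succ N ih => intro M w hw; exact ih (fun n => M (n + 1)) (ψ w) hw.2

lemma aux_main (X : OrientedRectangle Z) (ψ : Z → Z) (M : ℕ → Set Z)
    (hM : ∀ n, StretchesTo (M n) ψ X X) :
    ∃ C : Set Z, IsCompact C ∧ IsConnected C ∧ (C ∩ X.down).Nonempty ∧ (C ∩ X.up).Nonempty ∧
      ∀ w ∈ C, ∀ n, ψ^[n] w ∈ M n := by
  have hE := fun N => auxE_stretch X ψ N M hM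
  have hcl : ∀ N, IsClosed (auxE X ψ N M) := fun N => (hE N).1.isClosed
  obtain ⟨C, hCS, h1, h2, h3, h4⟩ := aux_rect X (⋂ N, auxE X ψ N M) (isClosed_iInter hcl) (by
    intro γ hγ hγX he
    have hclt : ∀ N, IsClosed (Icc (0 : ℝ) 1 ∩ γ ⁻¹' auxE X ψ N M) := fun N =>
      hγ.preimage_isClosed_of_isClosed isClosed_Icc (hcl N)
    obtain ⟨t, ht⟩ := IsCompact.nonempty_iInter_of_sequence_nonempty_isCompact_isClosed
      (fun N => Icc (0 : ℝ) 1 ∩ γ ⁻¹' auxE X ψ N M)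
      (fun N t ht => ⟨ht.1, auxE_anti X ψ N M (fun n => (hM n).2.1) ht.2⟩)
      (fun N => by
        obtain ⟨a, b, ha, hb, hab, hin, -⟩ := (hE N).2.2.2 γ hγ hγX (Or.inl he)
        exact ⟨a, ha, (hin a ⟨le_rfl, hab⟩).1⟩)
      (isCompact_Icc.of_isClosed_subset (hclt 0) inter_subset_left) hclt
    exact ⟨t, mem_iInter.2 fun N => (mem_iInter.1 ht N).2⟩)
  exact ⟨C, h1, h2, h3, h4, fun w hw n => auxE_orbit X ψ n M w (mem_iInter.1 (hCS hw) (n + 1))⟩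

end Helpers

/-- continua with prescribed forward itineraries for linked twist maps.
Under the stretching hypotheses, for every one-sided symbol sequence
`s : ℕ → Fin m₁ × Fin m₂` there is a compact connected set
`C ⊆ H' (s 0) = H (s 0).1 ∩ Φ⁻¹(K (s 0).2)` meeting both the down and the up side of
`R₁`, such that every point of `C` starts a forward orbit of `ψ = Ψ ∘ Φ` with itinerary
`(H' (s n))ₙ`. -/
theorem linked_twist_continua {Z : Type*} [MetricSpace Z] (Φ Ψ : Z → Z)
    (R₁ R₂ : OrientedRectangle Z) (m₁ m₂ : ℕ) (hm₁ : 1 ≤ m₁) (hm₂ : 1 ≤ m₂)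
    (H : Fin m₁ → Set Z) (K : Fin m₂ → Set Z)
    (hHd : Pairwise fun i j => Disjoint (H i) (H j))
    (hKd : Pairwise fun i j => Disjoint (K i) (K j))
    (hH : ∀ i, StretchesTo (H i) Φ R₁ R₂)
    (hK : ∀ j, StretchesTo (K j) Ψ R₂ R₁) :
    ∀ s : ℕ → Fin m₁ × Fin m₂,
      ∃ C : Set Z, IsCompact C ∧ IsConnected C ∧
        C ⊆ H (s 0).1 ∩ Φ ⁻¹' (K (s 0).2) ∧
        (C ∩ R₁.down).Nonempty ∧ (C ∩ R₁.up).Nonempty ∧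
        ∀ w ∈ C, ∃ y : ℕ → Z, y 0 = w ∧
          ∀ n : ℕ, y n ∈ H (s n).1 ∩ Φ ⁻¹' (K (s n).2) ∧ Ψ (Φ (y n)) = y (n + 1) := by
  intro s
  obtain ⟨C, h1, h2, h3, h4, h5⟩ := aux_main R₁ (Ψ ∘ Φ)
    (fun n => H (s n).1 ∩ Φ ⁻¹' (K (s n).2)) (fun n => (hH _).aux_comp (hK _))
  refine ⟨C, h1, h2, fun w hw => h5 w hw 0, h3, h4, fun w hw => ?_⟩
  refine ⟨fun n => (Ψ ∘ Φ)^[n] w, rfl, fun n => ⟨h5 w hw n, ?_⟩⟩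
  simp only [Function.iterate_succ_apply', Function.comp_apply]
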